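/- arXiv:0903.4130 — 4 statements merged into one kernel-verified Lean document; each statement's English description precedes it below -/
import Mathlib

section
/- For all positive reals A, B, C: (log((B+C)/C) + log((A+B+C)/A)) − (log((A+B)/B) + log((A+B+C)/C)) = log(((B+C)·B)/(A·(A+B))), and log(((B+C)·B)/(A·(A+B))) < 2·log((B+C)/A). (This is sub-case (iii) of the delete-min analysis, case 3(a): linking (a ↗ (c ↗ b)) when both roots are active; A, B, C are the numbers of white nodes in the trees a, b, c.) -/
theorem stmt_9 (A B C : ℝ) (hA : 0 < A) (hB : 0 < B) (hC : 0 < C) :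
    (Real.logb 2 ((B + C) / C) + Real.logb 2 ((A + B + C) / A))
      - (Real.logb 2 ((A + B) / B) + Real.logb 2 ((A + B + C) / C))
      = Real.logb 2 (((B + C) * B) / (A * (A + B))) ∧
    Real.logb 2 (((B + C) * B) / (A * (A + B))) < 2 * Real.logb 2 ((B + C) / A) := by
  constructor
  · rw [← Real.logb_mul (by positivity) (by positivity),
      ← Real.logb_mul (by positivity) (by positivity),
      ← Real.logb_div (by positivity) (by positivity)]
    congr 1
    field_simp
  · have h : 2 * Real.logb 2 ((B + C) / A) = Real.logb 2 (((B + C) / A) ^ 2) := by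
      rw [Real.logb_pow]
      norm_num
    rw [h]
    refine Real.logb_lt_logb one_lt_two (by positivity) ?_
    rw [div_pow, div_lt_div_iff₀ (by positivity) (by positivity), ← sub_pos]
    have hpos : 0 < (B + C) * A * (B * B + C * A + C * B) := by positivity
    linear_combination hpos
end

section
/- For all positive reals A, B, C: (log((B+C)/B) + log((A+B+C)/A)) − (log((A+B)/B) + log((A+B+C)/C)) = log(((B+C)·C)/(A·(A+B))), and log(((B+C)·C)/(A·(A+B))) < 2·log((B+C)/A). (This is sub-case (iv) of the delete-min analysis, case 3(a): linking (a ↗ (b ↗ c)) when both roots are active; A, B, C are the numbers of white nodes in the trees a, b, c.) -/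
theorem stmt_10 (A B C : ℝ) (hA : 0 < A) (hB : 0 < B) (hC : 0 < C) :
    (Real.logb 2 ((B + C) / B) + Real.logb 2 ((A + B + C) / A))
      - (Real.logb 2 ((A + B) / B) + Real.logb 2 ((A + B + C) / C))
      = Real.logb 2 (((B + C) * C) / (A * (A + B))) ∧
    Real.logb 2 (((B + C) * C) / (A * (A + B))) < 2 * Real.logb 2 ((B + C) / A) := by
  constructor
  · rw [← Real.logb_mul (by positivity) (by positivity),
      ← Real.logb_mul (by positivity) (by positivity),
      ← Real.logb_div (by positivity) (by positivity)]
    congr 1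
    field_simp
  · have two_mul_logb : 2 * Real.logb 2 ((B + C) / A) = Real.logb 2 (((B + C) / A) ^ 2) := by
      rw [Real.logb_pow, Nat.cast_ofNat]
    rw [two_mul_logb]
    refine Real.logb_lt_logb one_lt_two (by positivity) ?_
    rw [div_pow, div_lt_div_iff₀ (by positivity) (by positivity)]
    have key : C * A < (B + C) * (A + B) := by nlinarith [mul_pos hA hB, mul_pos hB hC]
    calc (B + C) * C * A ^ 2 = ((B + C) * A) * (C * A) := by ring
      _ < ((B + C) * A) * ((B + C) * (A + B)) := by gcongr
      _ = (B + C) ^ 2 * (A * (A + B)) := by ring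
end

section
/- Let m and n be natural numbers, let A : ℕ → ℝ satisfy A(0) ≥ 1, A(i+1) = A(i) + D(i) with D(i) ≥ 0 for all i < m, and A(m) ≤ n. Then the number of indices i < m with D(i) > A(i)/2 is at most log n / log(3/2). -/
/-- A positive quantity growing by nonnegative increments gains a factor `3 / 2` at every step
whose increment exceeds half of the current value. -/
theorem pow_card_filter_half_lt_le {A D : ℕ → ℝ} (hA0 : 1 ≤ A 0) (m : ℕ)
    (hstep : ∀ i < m, A (i + 1) = A i + D i) (hD : ∀ i < m, 0 ≤ D i) :
    (3 / 2 : ℝ) ^ ((Finset.range m).filter (fun i => A i / 2 < D i)).card ≤ A m := by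
  induction m with
  | zero => simpa using hA0
  | succ k ih =>
    have hk := ih (fun i hi => hstep i (by lia)) (fun i hi => hD i (by lia))
    rw [Finset.range_add_one, Finset.filter_insert, hstep k k.lt_succ_self]
    split_ifs with h
    · rw [Finset.card_insert_of_notMem (by simp), pow_succ]
      linarith
    · linarith [hD k k.lt_succ_self]

theorem stmt_11 (m n : ℕ) (A D : ℕ → ℝ)
    (hA0 : 1 ≤ A 0)
    (hstep : ∀ i < m, A (i + 1) = A i + D i)
    (hD : ∀ i < m, 0 ≤ D i)
    (hAm : A m ≤ (n : ℝ)) :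
    (((Finset.range m).filter (fun i => A i / 2 < D i)).card : ℝ)
      ≤ Real.logb 2 (n : ℝ) / Real.logb 2 (3 / 2) := by
  have h := (pow_card_filter_half_lt_le hA0 m hstep hD).trans hAm
  rw [le_div_iff₀ (Real.logb_pos (by norm_num) (by norm_num)), ← Real.logb_pow]
  exact Real.logb_le_logb_of_le (by norm_num) (by positivity) h
end

section
/- Let m be a natural number and let A : ℕ → ℝ satisfy A(0) > 0 and A(i+1) = A(i) + D(i) with D(i) ≥ 0 for all i < m. Then ∑_{i < m, D(i) > A(i)} log(D(i)/A(i)) ≤ log(A(m)/A(0)), where the sum is taken only over indices i with D(i) > A(i). -/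
theorem stmt_12 (m : ℕ) (A D : ℕ → ℝ)
    (hA0 : 0 < A 0)
    (hstep : ∀ i < m, A (i + 1) = A i + D i)
    (hD : ∀ i < m, 0 ≤ D i) :
    (∑ i ∈ (Finset.range m).filter (fun i => A i < D i), Real.logb 2 (D i / A i))
      ≤ Real.logb 2 (A m / A 0) := by
  have hpos : ∀ i ≤ m, 0 < A i := by
    intro i
    induction i with
    | zero => exact fun _ => hA0
    | succ k ih =>
      intro hk
      rw [hstep k hk]
      exact add_pos_of_pos_of_nonneg (ih (Nat.le_of_succ_le hk)) (hD k hk)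
  rw [Finset.sum_filter, Real.logb_div (hpos m le_rfl).ne' hA0.ne',
    ← Finset.sum_range_sub (fun i => Real.logb 2 (A i))]
  refine Finset.sum_le_sum fun i hi => ?_
  have hi : i < m := Finset.mem_range.mp hi
  have hAi := hpos i hi.le
  rw [hstep i hi]
  split_ifs with h
  · rw [Real.logb_div (hAi.trans h).ne' hAi.ne']
    exact sub_le_sub_right
      (Real.logb_le_logb_of_le one_lt_two (hAi.trans h) (le_add_of_nonneg_left hAi.le)) _
  · exact sub_nonneg.mpr
      (Real.logb_le_logb_of_le one_lt_two hAi (le_add_of_nonneg_right (hD i hi)))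
end
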